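/- Let A ∈ ℝ^{4×3} be a matrix that cannot be eliminated at any of its three columns and that has no forbidden pattern. Then, after suitably permuting rows and columns, the sign pattern of A is: row 1 = (+,+,0), row 2 = (+,−,0), row 3 = (−,0,+), row 4 = (−,0,−). -/

import Mathlib

open Matrix Finset
open scoped Classical

/-- `A` has a forbidden pattern: there are `lam ≥ 1` rows and columns, with
orderings (injective enumerations) `r`, `c`, such that in column `c l` all rows
of the pattern other than `r l`, `r (l+1)` vanish (cyclically), and
`A (r l) (c l) * A (r (l+1)) (c l) < 0` for every `l`. -/
def HasFP {m n : ℕ} (A : Matrix (Fin m) (Fin n) ℝ) : Prop :=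
  ∃ lam : ℕ, ∃ r : Fin (lam + 1) → Fin m, ∃ c : Fin (lam + 1) → Fin n,
    Function.Injective r ∧ Function.Injective c ∧
    (∀ l k : Fin (lam + 1), k ≠ l → k ≠ l + 1 → A (r k) (c l) = 0) ∧
    (∀ l : Fin (lam + 1), A (r l) (c l) * A (r (l + 1)) (c l) < 0)

/-- `A`, restricted to the set `S` of remaining columns, can be eliminated at column `j`. -/
def CanElim {m n : ℕ} (A : Matrix (Fin m) (Fin n) ℝ) (S : Finset (Fin n)) (j : Fin n) : Prop :=
  (∀ i, 0 < A i j → ∀ j' ∈ S, j' ≠ j → A i j' = 0) ∨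
  (∀ i, A i j < 0 → ∀ j' ∈ S, j' ≠ j → A i j' = 0)

/-- `A` has an elimination ordering. -/
def HasEO {m n : ℕ} (A : Matrix (Fin m) (Fin n) ℝ) : Prop :=
  ∃ e : Fin n ≃ Fin n, ∀ t : Fin n,
    CanElim A (Finset.univ.filter fun c => ∀ s : Fin n, s < t → e s ≠ c) (e t)

/-- `x ∈ {0,…,d}ⁿ` is a feasible solution of the integer linear system `A x ≥ b`. -/
def Feas {m n : ℕ} (d : ℕ) (A : Matrix (Fin m) (Fin n) ℝ) (b : Fin m → ℝ)
    (x : Fin n → ℕ) : Prop :=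
  (∀ j, x j ≤ d) ∧ ∀ i, b i ≤ ∑ j, A i j * (x j : ℝ)

/-- Adjacency in the solution graph `G(A,b)`: both endpoints are feasible and
their Hamming distance is `1`. -/
def SGAdj {m n : ℕ} (d : ℕ) (A : Matrix (Fin m) (Fin n) ℝ) (b : Fin m → ℝ)
    (x y : Fin n → ℕ) : Prop :=
  Feas d A b x ∧ Feas d A b y ∧ hammingDist x y = 1

/-- The solution graph `G(A,b)` is connected. -/
def SGConn {m n : ℕ} (d : ℕ) (A : Matrix (Fin m) (Fin n) ℝ) (b : Fin m → ℝ) : Prop :=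
  ∀ x y : Fin n → ℕ, Feas d A b x → Feas d A b y →
    Relation.ReflTransGen (SGAdj d A b) x y

/-- `A` is universally connected. -/
def UnivConn {m n : ℕ} (d : ℕ) (A : Matrix (Fin m) (Fin n) ℝ) : Prop :=
  ∀ b : Fin m → ℝ, SGConn d A b

def s8opp : SignType → SignType → Bool
  | .pos, .neg => true
  | .neg, .pos => true
  | _, _ => false

def s8nz : SignType → Bool
  | .zero => false
  | _ => true

def s8P : SignType → Bool
  | .pos => true
  | _ => false

def s8N : SignType → Bool
  | .neg => true
  | _ => false

def s8ex (f : Fin 4 → Bool) : Bool := f 0 || (f 1 || (f 2 || f 3))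

/-- no forbidden 2x2 pattern in the two columns -/
def s8pair (a b : Fin 4 → SignType) : Bool :=
  !(s8ex fun i => s8ex fun k => s8opp (a i) (a k) && s8opp (b i) (b k))

def s8trip (a b c : Fin 4 → SignType) : Bool :=
  !(s8ex fun i => s8ex fun k => s8opp (a i) (a k) && s8ex fun l =>
    (!(s8nz (a l)) && (s8opp (b k) (b l) && (!(s8nz (b i)) && (s8opp (c l) (c i) && !(s8nz (c k)))))))

def s8el (a b c : Fin 4 → SignType) : Bool :=
  (s8ex fun i => s8P (a i) && (s8nz (b i) || s8nz (c i))) &&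
  (s8ex fun i => s8N (a i) && (s8nz (b i) || s8nz (c i)))

def s8goal (a b c : Fin 4 → SignType) : Bool :=
  (s8ex fun i => s8P (a i) && (s8P (b i) && !(s8nz (c i)))) &&
  ((s8ex fun i => s8P (a i) && (s8N (b i) && !(s8nz (c i)))) &&
  ((s8ex fun i => s8N (a i) && (!(s8nz (b i)) && s8P (c i))) &&
  (s8ex fun i => s8N (a i) && (!(s8nz (b i)) && s8N (c i)))))

def s8all1 (f : SignType → Bool) : Bool := f .zero && (f .pos && f .neg)

def s8mk (x y z w : SignType) : Fin 4 → SignType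
  | 0 => x
  | 1 => y
  | 2 => z
  | 3 => w

def s8all (f : (Fin 4 → SignType) → Bool) : Bool :=
  s8all1 fun x => s8all1 fun y => s8all1 fun z => s8all1 fun w => f (s8mk x y z w)

def s8pm (a : Fin 4 → SignType) : Bool := (s8ex fun i => s8P (a i)) && (s8ex fun i => s8N (a i))

def s8main : Bool :=
  s8all fun a => !(s8pm a) || s8all fun b => !(s8pm b && s8pair a b) || s8all fun c =>
    !(s8pm c && (s8pair a c && (s8pair b c && (s8el a b c && (s8el b a c &&
      (s8el c a b && s8trip a b c)))))) ||
    (s8goal a b c || (s8goal a c b || (s8goal b a c || (s8goal b c a ||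
      (s8goal c a b || s8goal c b a)))))

set_option maxRecDepth 100000 in
theorem s8main_true : s8main = true := by decide +kernel

theorem s8all1_spec {f : SignType → Bool} (h : s8all1 f = true) (x : SignType) : f x = true := by
  simp only [s8all1, Bool.and_eq_true] at h
  cases x
  · exact h.1
  · exact h.2.2
  · exact h.2.1

theorem s8all_spec {f : (Fin 4 → SignType) → Bool} (h : s8all f = true) (a : Fin 4 → SignType) :
    f a = true := by
  have := s8all1_spec (s8all1_spec (s8all1_spec (s8all1_spec h (a 0)) (a 1)) (a 2)) (a 3)
  have e : s8mk (a 0) (a 1) (a 2) (a 3) = a := by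
    funext i; fin_cases i <;> rfl
  rwa [e] at this

theorem s8ex_spec (f : Fin 4 → Bool) : s8ex f = true ↔ ∃ i, f i = true := by
  simp [s8ex, Fin.exists_fin_succ]

theorem s8P_spec (x : ℝ) : s8P (SignType.sign x) = true ↔ 0 < x := by
  rcases lt_trichotomy x 0 with h | h | h
  · simp [sign_neg h, s8P, h.le]
  · simp [h, s8P]
  · simp [sign_pos h, s8P, h]

theorem s8N_spec (x : ℝ) : s8N (SignType.sign x) = true ↔ x < 0 := by
  rcases lt_trichotomy x 0 with h | h | h
  · simp [sign_neg h, s8N, h]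
  · simp [h, s8N]
  · simp [sign_pos h, s8N, h.le]

theorem s8nz_spec (x : ℝ) : s8nz (SignType.sign x) = true ↔ x ≠ 0 := by
  rcases lt_trichotomy x 0 with h | h | h
  · simp [sign_neg h, s8nz, h.ne]
  · simp [h, s8nz]
  · simp [sign_pos h, s8nz, h.ne']

theorem s8opp_spec (x y : ℝ) : s8opp (SignType.sign x) (SignType.sign y) = true ↔ x * y < 0 := by
  rw [mul_neg_iff]
  rcases lt_trichotomy x 0 with h | h | h <;> rcases lt_trichotomy y 0 with k | k | k <;>
    simp [sign_neg, sign_pos, s8opp, h, k, h.le, k.le]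

theorem s8goal_spec (A : Matrix (Fin 4) (Fin 3) ℝ) (p q r : Fin 3)
    (hpq : p ≠ q) (hpr : p ≠ r) (hqr : q ≠ r)
    (h : s8goal (fun i => SignType.sign (A i p)) (fun i => SignType.sign (A i q))
      (fun i => SignType.sign (A i r)) = true) :
    ∃ σ : Fin 4 ≃ Fin 4, ∃ τ : Fin 3 ≃ Fin 3,
      0 < A (σ 0) (τ 0) ∧ 0 < A (σ 0) (τ 1) ∧ A (σ 0) (τ 2) = 0 ∧
      0 < A (σ 1) (τ 0) ∧ A (σ 1) (τ 1) < 0 ∧ A (σ 1) (τ 2) = 0 ∧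
      A (σ 2) (τ 0) < 0 ∧ A (σ 2) (τ 1) = 0 ∧ 0 < A (σ 2) (τ 2) ∧
      A (σ 3) (τ 0) < 0 ∧ A (σ 3) (τ 1) = 0 ∧ A (σ 3) (τ 2) < 0 := by
  simp only [s8goal, Bool.and_eq_true, s8ex_spec, s8P_spec, s8N_spec, Bool.not_eq_true',
    ← Bool.not_eq_true, s8nz_spec, not_not] at h
  obtain ⟨⟨i, hi1, hi2, hi3⟩, ⟨j, hj1, hj2, hj3⟩, ⟨k, hk1, hk2, hk3⟩, ⟨l, hl1, hl2, hl3⟩⟩ := h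
  have n1 : i ≠ j := by rintro rfl; linarith
  have n2 : i ≠ k := by rintro rfl; linarith
  have n3 : i ≠ l := by rintro rfl; linarith
  have n4 : j ≠ k := by rintro rfl; linarith
  have n5 : j ≠ l := by rintro rfl; linarith
  have n6 : k ≠ l := by rintro rfl; linarith
  have hs : Function.Injective ![i, j, k, l] := by
    intro x y
    fin_cases x <;> fin_cases y <;> simp [n1, n2, n3, n4, n5, n6, n1.symm, n2.symm, n3.symm,
      n4.symm, n5.symm, n6.symm]
  have ht : Function.Injective ![p, q, r] := by
    intro x y
    fin_cases x <;> fin_cases y <;> simp [hpq, hpr, hqr, hpq.symm, hpr.symm, hqr.symm]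
  exact ⟨Equiv.ofBijective _ (Finite.injective_iff_bijective.1 hs),
    Equiv.ofBijective _ (Finite.injective_iff_bijective.1 ht),
    hi1, hi2, hi3, hj1, hj2, hj3, hk1, hk2, hk3, hl1, hl2, hl3⟩

theorem s8pair_of (A : Matrix (Fin 4) (Fin 3) ℝ) (hfp : ¬ HasFP A) (p q : Fin 3) (hpq : p ≠ q) :
    s8pair (fun i => SignType.sign (A i p)) (fun i => SignType.sign (A i q)) = true := by
  by_contra hc
  simp only [s8pair, Bool.not_eq_true, Bool.not_eq_false', s8ex_spec, Bool.and_eq_true,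
    s8opp_spec] at hc
  obtain ⟨i, k, h1, h2⟩ := hc
  have n : i ≠ k := by rintro rfl; nlinarith [mul_self_nonneg (A i p)]
  refine hfp ⟨1, ![i, k], ![p, q], ?_, ?_, ?_, ?_⟩
  · intro x y
    fin_cases x <;> fin_cases y <;> simp [n, n.symm]
  · intro x y
    fin_cases x <;> fin_cases y <;> simp [hpq, hpq.symm]
  · intro x y
    fin_cases x <;> fin_cases y <;> simp
  · intro x
    fin_cases x
    · simpa using h1
    · simpa [mul_comm] using h2

theorem s8trip_of (A : Matrix (Fin 4) (Fin 3) ℝ) (hfp : ¬ HasFP A) :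
    s8trip (fun i => SignType.sign (A i 0)) (fun i => SignType.sign (A i 1))
      (fun i => SignType.sign (A i 2)) = true := by
  by_contra hc
  rw [Bool.not_eq_true, s8trip, Bool.not_eq_false'] at hc
  simp only [s8ex_spec, Bool.and_eq_true,
    s8opp_spec, Bool.not_eq_true'] at hc
  obtain ⟨i, k, h1, l, h2, h3, h4, h5, h6⟩ := hc
  have z (x : ℝ) (h : s8nz (SignType.sign x) = false) : x = 0 := by
    by_contra hx
    rw [← ne_eq, ← s8nz_spec, h] at hx
    simp at hx
  have n1 : i ≠ k := by rintro rfl; nlinarith [mul_self_nonneg (A i 0)]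
  have n2 : k ≠ l := by rintro rfl; nlinarith [mul_self_nonneg (A k 1)]
  have n3 : l ≠ i := by rintro rfl; nlinarith [mul_self_nonneg (A l 2)]
  refine hfp ⟨2, ![i, k, l], ![0, 1, 2], ?_, ?_, ?_, ?_⟩
  · intro x y
    fin_cases x <;> fin_cases y <;> simp [n1, n2, n3, n1.symm, n2.symm, n3.symm]
  · decide
  · intro x y
    fin_cases x <;> fin_cases y <;> simp [z _ h2, z _ h4, z _ h6]
  · intro x
    fin_cases x
    · exact h1
    · exact h3
    · exact h5

theorem s8el_of (A : Matrix (Fin 4) (Fin 3) ℝ) (p q r : Fin 3)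
    (hall : ∀ x : Fin 3, x ≠ p → x = q ∨ x = r)
    (h : ¬ CanElim A Finset.univ p) :
    s8el (fun i => SignType.sign (A i p)) (fun i => SignType.sign (A i q))
      (fun i => SignType.sign (A i r)) = true := by
  unfold CanElim at h
  push Not at h
  obtain ⟨⟨i, hi, x, -, hx, hx'⟩, ⟨k, hk, y, -, hy, hy'⟩⟩ := h
  simp only [s8el, Bool.and_eq_true, Bool.or_eq_true, s8ex_spec, s8P_spec, s8N_spec, s8nz_spec]
  refine ⟨⟨i, hi, ?_⟩, ⟨k, hk, ?_⟩⟩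
  · rcases hall x hx with rfl | rfl
    · exact Or.inl hx'
    · exact Or.inr hx'
  · rcases hall y hy with rfl | rfl
    · exact Or.inl hy'
    · exact Or.inr hy'

theorem s8pm_of (a b c : Fin 4 → SignType) (h : s8el a b c = true) : s8pm a = true := by
  simp only [s8el, s8pm, Bool.and_eq_true, s8ex_spec] at h ⊢
  obtain ⟨⟨i, hi, -⟩, ⟨k, hk, -⟩⟩ := h
  exact ⟨⟨i, hi⟩, ⟨k, hk⟩⟩

theorem stmt8 (A : Matrix (Fin 4) (Fin 3) ℝ)
    (helim : ∀ j : Fin 3, ¬ CanElim A Finset.univ j)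
    (hfp : ¬ HasFP A) :
    ∃ σ : Fin 4 ≃ Fin 4, ∃ τ : Fin 3 ≃ Fin 3,
      0 < A (σ 0) (τ 0) ∧ 0 < A (σ 0) (τ 1) ∧ A (σ 0) (τ 2) = 0 ∧
      0 < A (σ 1) (τ 0) ∧ A (σ 1) (τ 1) < 0 ∧ A (σ 1) (τ 2) = 0 ∧
      A (σ 2) (τ 0) < 0 ∧ A (σ 2) (τ 1) = 0 ∧ 0 < A (σ 2) (τ 2) ∧
      A (σ 3) (τ 0) < 0 ∧ A (σ 3) (τ 1) = 0 ∧ A (σ 3) (τ 2) < 0 := by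
  have e0 := s8el_of A 0 1 2 (by decide) (helim 0)
  have e1 := s8el_of A 1 0 2 (by decide) (helim 1)
  have e2 := s8el_of A 2 0 1 (by decide) (helim 2)
  have h1 := s8all_spec s8main_true (fun i => SignType.sign (A i 0))
  rw [s8pm_of _ _ _ e0, Bool.not_true, Bool.false_or] at h1
  have h2 := s8all_spec h1 (fun i => SignType.sign (A i 1))
  rw [s8pm_of _ _ _ e1, s8pair_of A hfp 0 1 (by decide), Bool.and_self, Bool.not_true,
    Bool.false_or] at h2
  have h3 := s8all_spec h2 (fun i => SignType.sign (A i 2))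
  rw [s8pm_of _ _ _ e2, s8pair_of A hfp 0 2 (by decide), s8pair_of A hfp 1 2 (by decide),
    e0, e1, e2, s8trip_of A hfp] at h3
  simp only [Bool.and_self, Bool.not_true, Bool.false_or, Bool.or_eq_true] at h3
  rcases h3 with h | h | h | h | h | h
  all_goals exact s8goal_spec A _ _ _ (by decide) (by decide) (by decide) h
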